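/- Let L be an M×M symmetric positive semidefinite real matrix admitting the decomposition L = U Σ Uᵀ, where U is an M×m real matrix with orthonormal columns (UᵀU = I_m), Σ is an m×m symmetric positive definite matrix, and E₀ is an M×k real matrix with orthonormal columns (E₀ᵀE₀ = I_k) satisfying UᵀE₀ = 0 and U Uᵀ + E₀E₀ᵀ = I_M. Let A and A_s be M×N real matrices, set Ē = Aᵀ E₀ and Ē_s = A_sᵀ E₀, and assume Ē_s = Ē and that ĒᵀĒ is invertible. Let S be an N×N doubly stochastic matrix with nonnegative entries, and let b ∈ ℝ^N satisfy Ēᵀ b = 0. Suppose there exist indices i, j, k with S_{ij} > 0, S_{ik} > 0 and b_j ≠ b_k. Then there exists μ₀ > 0 such that for all μ with 0 < μ < μ₀, the matrices μ A Aᵀ + L and μ A_s A_sᵀ + L are invertible and ‖(I − μ A_sᵀ(μ A_s A_sᵀ + L)⁻¹ A_s)(S b)‖² < ‖(I − μ Aᵀ(μ A Aᵀ + L)⁻¹ A) b‖². -/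

import Mathlib

open Matrix Filter

/-- A stochastic row satisfies Jensen's inequality for the square. -/
theorem sq_sum_mul_le_sum_mul_sq {ι : Type*} [Fintype ι] (p b : ι → ℝ)
    (hp : ∀ j, 0 ≤ p j) (hsum : ∑ j, p j = 1) :
    (∑ j, p j * b j) ^ 2 ≤ ∑ j, p j * b j ^ 2 := by
  simpa using (even_two.convexOn_pow (𝕜 := ℝ)).map_sum_le (t := Finset.univ) (w := p) (p := b)
    (fun j _ => hp j) hsum (fun j _ => Set.mem_univ _)

/-- Jensen's inequality for the square is strict if `b` differs on the support of `p`. -/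
theorem sq_sum_mul_lt_sum_mul_sq {ι : Type*} [Fintype ι] (p b : ι → ℝ)
    (hp : ∀ j, 0 ≤ p j) (hsum : ∑ j, p j = 1)
    {j l : ι} (hj : 0 < p j) (hl : 0 < p l) (hb : b j ≠ b l) :
    (∑ j, p j * b j) ^ 2 < ∑ j, p j * b j ^ 2 := by
  set c := ∑ j, p j * b j with hc
  have hvar : ∑ j, p j * (b j - c) ^ 2 = ∑ j, p j * b j ^ 2 - c ^ 2 := by
    have : ∀ j, p j * (b j - c) ^ 2 = p j * b j ^ 2 - 2 * c * (p j * b j) + c ^ 2 * p j :=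
      fun j => by ring
    simp only [this, Finset.sum_add_distrib, Finset.sum_sub_distrib, ← Finset.mul_sum, hsum, ← hc]
    ring
  have hpos : 0 < ∑ j, p j * (b j - c) ^ 2 := by
    refine Finset.sum_pos' (fun i _ => mul_nonneg (hp i) (sq_nonneg _)) ?_
    by_cases hjc : b j = c
    · exact ⟨l, Finset.mem_univ _, mul_pos hl (sq_pos_of_ne_zero (sub_ne_zero.mpr fun h => hb (hjc.trans h.symm)))⟩
    · exact ⟨j, Finset.mem_univ _, mul_pos hj (sq_pos_of_ne_zero (sub_ne_zero.mpr hjc))⟩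
  linarith

/-- A doubly stochastic matrix strictly decreases the Euclidean norm of a vector that is not
constant on the support of some row. -/
theorem dotProduct_mulVec_self_lt {ι : Type*} [Fintype ι] (S : Matrix ι ι ℝ)
    (hS : ∀ i j, 0 ≤ S i j) (hrow : ∀ i, ∑ j, S i j = 1) (hcol : ∀ j, ∑ i, S i j = 1)
    (b : ι → ℝ) (h : ∃ i j l, 0 < S i j ∧ 0 < S i l ∧ b j ≠ b l) :
    S *ᵥ b ⬝ᵥ S *ᵥ b < b ⬝ᵥ b := by
  obtain ⟨i, j, l, hj, hl, hb⟩ := h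
  calc S *ᵥ b ⬝ᵥ S *ᵥ b = ∑ i, (∑ j, S i j * b j) ^ 2 := by
        simp [dotProduct, mulVec, sq]
    _ < ∑ i, ∑ j, S i j * b j ^ 2 :=
        Finset.sum_lt_sum (fun i _ => sq_sum_mul_le_sum_mul_sq _ _ (hS i) (hrow i))
          ⟨i, Finset.mem_univ _, sq_sum_mul_lt_sum_mul_sq _ _ (hS i) (hrow i) hj hl hb⟩
    _ = b ⬝ᵥ b := by
        rw [Finset.sum_comm]
        simp [← Finset.sum_mul, hcol, dotProduct, sq]

/-- `μ A Aᵀ + U Σ Uᵀ` is invertible when `Aᵀ` is injective on the range of `E₀`. -/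
theorem isUnit_det_smul_mul_transpose_add {M N m k : Type*} [Fintype M] [DecidableEq M]
    [Fintype N] [Fintype m] [Fintype k] [DecidableEq k]
    (U : Matrix M m ℝ) (Sig : Matrix m m ℝ) (E₀ : Matrix M k ℝ) (hSig : Sig.PosDef)
    (hcomp : U * Uᵀ + E₀ * E₀ᵀ = 1) (A : Matrix M N ℝ)
    (hE : IsUnit ((Aᵀ * E₀)ᵀ * (Aᵀ * E₀)).det) {μ : ℝ} (hμ : 0 < μ) :
    IsUnit (μ • (A * Aᵀ) + U * Sig * Uᵀ).det := by
  rw [isUnit_iff_ne_zero]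
  intro hdet
  obtain ⟨x, hx, hGx⟩ := exists_mulVec_eq_zero_iff.mpr hdet
  have hquad : μ * (Aᵀ *ᵥ x ⬝ᵥ Aᵀ *ᵥ x) + Uᵀ *ᵥ x ⬝ᵥ Sig *ᵥ (Uᵀ *ᵥ x) = 0 := by
    have := congrArg (x ⬝ᵥ ·) hGx
    simpa [add_mulVec, smul_mulVec, ← mulVec_mulVec, dotProduct_mulVec, ← mulVec_transpose]
      using this
  have hA0 : 0 ≤ Aᵀ *ᵥ x ⬝ᵥ Aᵀ *ᵥ x := Finset.sum_nonneg fun _ _ => mul_self_nonneg _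
  have hU0 : 0 ≤ Uᵀ *ᵥ x ⬝ᵥ Sig *ᵥ (Uᵀ *ᵥ x) := by
    simpa using hSig.posSemidef.dotProduct_mulVec_nonneg (Uᵀ *ᵥ x)
  have hUx : Uᵀ *ᵥ x = 0 := by
    by_contra hne
    have : 0 < Uᵀ *ᵥ x ⬝ᵥ Sig *ᵥ (Uᵀ *ᵥ x) := by
      simpa using hSig.dotProduct_mulVec_pos hne
    nlinarith
  have hAx : Aᵀ *ᵥ x = 0 := dotProduct_self_eq_zero.mp (by nlinarith)
  have hxE : x = E₀ *ᵥ (E₀ᵀ *ᵥ x) := by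
    have := congrArg (· *ᵥ x) hcomp
    simpa [add_mulVec, ← mulVec_mulVec, hUx] using this.symm
  have hEx : E₀ᵀ *ᵥ x = 0 := by
    refine eq_zero_of_mulVec_eq_zero hE.ne_zero ?_
    rw [← mulVec_mulVec, ← mulVec_mulVec, ← hxE, hAx, mulVec_zero]
  exact hx (by rw [hxE, hEx, mulVec_zero])

/-- The residual operator `I - μ Aᵀ (μ A Aᵀ + L)⁻¹ A` is a contraction. -/
theorem dotProduct_residual_self_le {M N : Type*} [Fintype M] [DecidableEq M]
    [Fintype N] [DecidableEq N] (L : Matrix M M ℝ) (hL : L.PosSemidef) (A : Matrix M N ℝ)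
    {μ : ℝ} (hμ : 0 ≤ μ) (hG : IsUnit (μ • (A * Aᵀ) + L).det) (v : N → ℝ) :
    (1 - μ • (Aᵀ * (μ • (A * Aᵀ) + L)⁻¹ * A)) *ᵥ v ⬝ᵥ
      (1 - μ • (Aᵀ * (μ • (A * Aᵀ) + L)⁻¹ * A)) *ᵥ v ≤ v ⬝ᵥ v := by
  obtain ⟨x, hx⟩ : ∃ x, x = (μ • (A * Aᵀ) + L)⁻¹ *ᵥ (A *ᵥ v) := ⟨_, rfl⟩
  obtain ⟨y, hy⟩ : ∃ y, y = (1 - μ • (Aᵀ * (μ • (A * Aᵀ) + L)⁻¹ * A)) *ᵥ v := ⟨_, rfl⟩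
  have hyx : y = v - μ • (Aᵀ *ᵥ x) := by
    simp [hy, hx, sub_mulVec, smul_mulVec, ← mulVec_mulVec]
  have hGx : μ • (A *ᵥ (Aᵀ *ᵥ x)) + L *ᵥ x = A *ᵥ v := by
    have : (μ • (A * Aᵀ) + L) *ᵥ x = A *ᵥ v := by
      rw [hx, mulVec_mulVec, mul_nonsing_inv _ hG, one_mulVec]
    simpa [add_mulVec, smul_mulVec, ← mulVec_mulVec] using this
  have hAy : A *ᵥ y = L *ᵥ x := by
    rw [hyx, mulVec_sub, mulVec_smul, ← hGx, add_sub_cancel_left]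
  have hcross : y ⬝ᵥ Aᵀ *ᵥ x = x ⬝ᵥ L *ᵥ x := by
    rw [dotProduct_mulVec, vecMul_transpose, hAy, dotProduct_comm]
  have hnonneg : 0 ≤ x ⬝ᵥ L *ᵥ x := by simpa using hL.dotProduct_mulVec_nonneg x
  have hsq : 0 ≤ Aᵀ *ᵥ x ⬝ᵥ Aᵀ *ᵥ x := Finset.sum_nonneg fun _ _ => mul_self_nonneg _
  have hv : v = y + μ • (Aᵀ *ᵥ x) := by rw [hyx, sub_add_cancel]
  have hexp : v ⬝ᵥ v = y ⬝ᵥ y + 2 * (μ * (x ⬝ᵥ L *ᵥ x)) +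
      μ ^ 2 * (Aᵀ *ᵥ x ⬝ᵥ Aᵀ *ᵥ x) := by
    rw [hv, add_dotProduct, dotProduct_add, dotProduct_add, smul_dotProduct, smul_dotProduct,
      dotProduct_smul, dotProduct_smul, dotProduct_comm (Aᵀ *ᵥ x) y, hcross]
    simp only [smul_eq_mul]
    ring
  rw [← hy, hexp]
  have h₁ := mul_nonneg hμ hnonneg
  have h₂ := mul_nonneg (sq_nonneg μ) hsq
  linarith

/-- If `A b = L w`, the residual operator moves `b` by `μ` times the residual of `Aᵀ w`. -/
theorem residual_mulVec_eq_sub {M N : Type*} [Fintype M] [DecidableEq M]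
    [Fintype N] [DecidableEq N] (L : Matrix M M ℝ) (A : Matrix M N ℝ)
    {μ : ℝ} (hG : IsUnit (μ • (A * Aᵀ) + L).det) (b : N → ℝ) (w : M → ℝ)
    (hw : A *ᵥ b = L *ᵥ w) :
    (1 - μ • (Aᵀ * (μ • (A * Aᵀ) + L)⁻¹ * A)) *ᵥ b =
      b - μ • ((1 - μ • (Aᵀ * (μ • (A * Aᵀ) + L)⁻¹ * A)) *ᵥ (Aᵀ *ᵥ w)) := by
  have hAb : A *ᵥ b = (μ • (A * Aᵀ) + L) *ᵥ w - μ • (A *ᵥ (Aᵀ *ᵥ w)) := by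
    simp [hw, add_mulVec, smul_mulVec]
  have hinv : (μ • (A * Aᵀ) + L)⁻¹ *ᵥ (A *ᵥ b) =
      w - μ • ((μ • (A * Aᵀ) + L)⁻¹ *ᵥ (A *ᵥ (Aᵀ *ᵥ w))) := by
    rw [hAb, mulVec_sub, mulVec_mulVec, nonsing_inv_mul _ hG, one_mulVec, mulVec_smul]
  simp only [sub_mulVec, one_mulVec, smul_mulVec, ← mulVec_mulVec, hinv, mulVec_sub, mulVec_smul]

/-- The squared Euclidean norm of a real vector as a dot product. -/
theorem norm_sq_withLp_symm_eq_dotProduct {ι : Type*} [Fintype ι] (v : ι → ℝ) :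
    ‖(WithLp.equiv 2 (ι → ℝ)).symm v‖ ^ 2 = v ⬝ᵥ v := by
  rw [EuclideanSpace.norm_sq_eq]
  simp [dotProduct, sq]

/-- Theorem 2 of the paper: smoothing strictly decreases the optical-flow
consistency score in the small-`μ` regime. With `L = UΣUᵀ`, `Ē = AᵀE₀ = A_sᵀE₀`,
`ĒᵀĒ` invertible, `S` doubly stochastic with nonnegative entries, `Ēᵀb = 0`,
and some row of `S` having two positive entries where `b` differs, there is
`μ₀ > 0` such that for all `0 < μ < μ₀` both `μAAᵀ + L` and `μA_sA_sᵀ + L` are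
invertible and
`‖(I − μA_sᵀ(μA_sA_sᵀ + L)⁻¹A_s)(Sb)‖² < ‖(I − μAᵀ(μAAᵀ + L)⁻¹A)b‖²`. -/
theorem stmt_10 {M N m k : ℕ}
    (L : Matrix (Fin M) (Fin M) ℝ) (hLpsd : L.PosSemidef)
    (U : Matrix (Fin M) (Fin m) ℝ) (Sig : Matrix (Fin m) (Fin m) ℝ)
    (E₀ : Matrix (Fin M) (Fin k) ℝ)
    (hSig : Sig.PosDef) (hL : L = U * Sig * Uᵀ)
    (hU : Uᵀ * U = 1) (hE₀ : E₀ᵀ * E₀ = 1) (hUE : Uᵀ * E₀ = 0)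
    (hcomp : U * Uᵀ + E₀ * E₀ᵀ = 1)
    (A As : Matrix (Fin M) (Fin N) ℝ)
    (hEs : Asᵀ * E₀ = Aᵀ * E₀)
    (hE : IsUnit ((Aᵀ * E₀)ᵀ * (Aᵀ * E₀)).det)
    (S : Matrix (Fin N) (Fin N) ℝ)
    (hS : ∀ i j, 0 ≤ S i j)
    (hrow : ∀ i, ∑ j, S i j = 1)
    (hcol : ∀ j, ∑ i, S i j = 1)
    (b : Fin N → ℝ) (hb : (Aᵀ * E₀)ᵀ.mulVec b = 0)
    (h : ∃ i j l, 0 < S i j ∧ 0 < S i l ∧ b j ≠ b l) :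
    ∃ μ₀ > (0 : ℝ), ∀ μ : ℝ, 0 < μ → μ < μ₀ →
      IsUnit (μ • (A * Aᵀ) + L).det ∧
      IsUnit (μ • (As * Asᵀ) + L).det ∧
      ‖(WithLp.equiv 2 (Fin N → ℝ)).symm
          ((1 - μ • (Asᵀ * (μ • (As * Asᵀ) + L)⁻¹ * As)).mulVec
            (S.mulVec b))‖ ^ 2
        < ‖(WithLp.equiv 2 (Fin N → ℝ)).symm
            ((1 - μ • (Aᵀ * (μ • (A * Aᵀ) + L)⁻¹ * A)).mulVec b)‖ ^ 2 := by
  have hlt := dotProduct_mulVec_self_lt S hS hrow hcol b h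
  obtain ⟨w, hw⟩ : ∃ w, A *ᵥ b = L *ᵥ w := by
    have hEb : E₀ᵀ *ᵥ (A *ᵥ b) = 0 := by
      simpa [transpose_mul, ← mulVec_mulVec] using hb
    have hSig_inv : Sig * Sig⁻¹ = 1 := mul_nonsing_inv _ hSig.det_pos.ne'.isUnit
    have hAb : A *ᵥ b = U *ᵥ (Uᵀ *ᵥ (A *ᵥ b)) := by
      have := congrArg (· *ᵥ (A *ᵥ b)) hcomp
      simp only [add_mulVec, ← mulVec_mulVec, one_mulVec, hEb, mulVec_zero, add_zero] at this
      exact this.symm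
    refine ⟨(U * Sig⁻¹ * Uᵀ) *ᵥ (A *ᵥ b), ?_⟩
    have hLU : L * (U * Sig⁻¹ * Uᵀ) = U * Uᵀ := by
      calc L * (U * Sig⁻¹ * Uᵀ) = U * (Sig * (Uᵀ * U) * Sig⁻¹) * Uᵀ := by
            simp only [hL, Matrix.mul_assoc]
        _ = U * Uᵀ := by rw [hU, Matrix.mul_one, hSig_inv, Matrix.mul_one]
    rw [mulVec_mulVec, hLU, ← mulVec_mulVec]
    exact hAb
  have hbb : 0 ≤ b ⬝ᵥ b := Finset.sum_nonneg fun _ _ => mul_self_nonneg _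
  have hww : 0 ≤ Aᵀ *ᵥ w ⬝ᵥ Aᵀ *ᵥ w := Finset.sum_nonneg fun _ _ => mul_self_nonneg _
  have hden : 0 < b ⬝ᵥ b + Aᵀ *ᵥ w ⬝ᵥ Aᵀ *ᵥ w + 1 := by linarith
  refine ⟨(b ⬝ᵥ b - S *ᵥ b ⬝ᵥ S *ᵥ b) / (b ⬝ᵥ b + Aᵀ *ᵥ w ⬝ᵥ Aᵀ *ᵥ w + 1),
    div_pos (sub_pos.mpr hlt) hden, fun μ hμ hμlt => ?_⟩
  have hG : IsUnit (μ • (A * Aᵀ) + L).det := by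
    rw [hL]
    exact isUnit_det_smul_mul_transpose_add U Sig E₀ hSig hcomp A hE hμ
  have hGs : IsUnit (μ • (As * Asᵀ) + L).det := by
    rw [hL]
    exact isUnit_det_smul_mul_transpose_add U Sig E₀ hSig hcomp As (hEs ▸ hE) hμ
  refine ⟨hG, hGs, ?_⟩
  rw [norm_sq_withLp_symm_eq_dotProduct, norm_sq_withLp_symm_eq_dotProduct]
  refine (dotProduct_residual_self_le L hLpsd As hμ.le hGs _).trans_lt ?_
  have hz := dotProduct_residual_self_le L hLpsd A hμ.le hG (Aᵀ *ᵥ w)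
  rw [residual_mulVec_eq_sub L A hG b w hw]
  generalize (1 - μ • (Aᵀ * (μ • (A * Aᵀ) + L)⁻¹ * A)) *ᵥ (Aᵀ *ᵥ w) = z at hz
  have hzz : 0 ≤ z ⬝ᵥ z := Finset.sum_nonneg fun _ _ => mul_self_nonneg _
  have hamgm : 0 ≤ (b - z) ⬝ᵥ (b - z) := Finset.sum_nonneg fun _ _ => mul_self_nonneg _
  simp only [sub_dotProduct, dotProduct_sub, smul_dotProduct, dotProduct_smul, smul_eq_mul,
    dotProduct_comm z b] at hamgm ⊢
  rw [lt_div_iff₀ hden] at hμlt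
  have h₁ := mul_nonneg hμ.le hamgm
  have h₂ := mul_le_mul_of_nonneg_left hz hμ.le
  have h₃ := mul_nonneg hμ.le (mul_nonneg hμ.le hzz)
  nlinarith
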